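/- For all k, m ≥ 1, the Hart–Sharir sequence S_k(m) contains no (not necessarily contiguous) subsequence a b c a c c b c with a, b, c pairwise distinct symbols (where the two middle occurrences c c need not be adjacent in S_k(m)); that is, S_k(m) avoids the pattern abcaccbc. -/

import Mathlib

/-! ### Sequences with special blocks, encoded as token lists

A sequence with special blocks is encoded as a list of tokens: `Tok.sym a` is an
occurrence of the symbol `a`, and `Tok.op` / `Tok.cl` are the opening and closing
parentheses delimiting the special blocks. -/

/-- Tokens of a symbol sequence with special blocks. -/
inductive Tok : Type where
  | sym : ℕ → Tok
  | op : Tok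
  | cl : Tok
deriving DecidableEq, Repr

/-- Tokens of an endpoint sequence with special blocks: `L a` / `R a` are the
left/right endpoint letters of the symbol `a`, and `op`/`cl` delimit blocks. -/
inductive ETok : Type where
  | L : ℕ → ETok
  | R : ℕ → ETok
  | op : ETok
  | cl : ETok
deriving DecidableEq, Repr

/-- Fresh relabeling of the symbols of the `i`-th local copy. -/
def loc (i a : ℕ) : ℕ := 2 * Nat.pair i a

/-- Relabeling of the global symbols. -/
def glob (a : ℕ) : ℕ := 2 * a + 1

/-- The underlying sequence of symbols of a token list (parentheses dropped). -/
def symsOf : List Tok → List ℕ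
  | [] => []
  | Tok.sym a :: r => a :: symsOf r
  | _ :: r => symsOf r

/-- Read a special block: the symbols up to (and excluding) the next closing
parenthesis, together with the remainder of the list after that parenthesis. -/
def takeBlock : List Tok → List ℕ × List Tok
  | [] => ([], [])
  | Tok.cl :: r => ([], r)
  | Tok.sym a :: r => ((takeBlock r).1.cons a, (takeBlock r).2)
  | Tok.op :: r => takeBlock r

theorem takeBlock_len : ∀ l : List Tok, (takeBlock l).2.length ≤ l.length := by
  intro l
  induction l with
  | nil => simp [takeBlock]
  | cons t r ih => cases t <;> simp [takeBlock] <;> omega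

/-- Auxiliary function for the shuffle `A • B`: traverse the `i`-th fresh copy of
`A` (relabeling its symbols by `loc i`), inserting the next global symbol of the
list `ins` (relabeled by `glob`) at the end of each special block and duplicating
the previously last symbol of that block immediately after the block.  The third
argument remembers the (relabeled) last symbol seen. -/
def copyIns (i : ℕ) : List Tok → List ℕ → Option ℕ → List Tok
  | [], _, _ => []
  | Tok.sym a :: r, ins, _ => Tok.sym (loc i a) :: copyIns i r ins (some (loc i a))
  | Tok.op :: r, ins, p => Tok.op :: copyIns i r ins p
  | Tok.cl :: r, b :: ins, some q =>
      Tok.sym (glob b) :: Tok.cl :: Tok.sym q :: copyIns i r ins (some q)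
  | Tok.cl :: r, ins, p => Tok.cl :: copyIns i r ins p

/-- The modified copy `Aᵢ'` of `A` used in the shuffle `A • B`: the symbols of the
`i`-th special block `blk` of `B` are inserted into the special blocks of the copy,
and another copy of the last symbol of `blk` is appended at the very end. -/
def copyA (i : ℕ) (A : List Tok) (blk : List ℕ) : List Tok :=
  copyIns i A blk none ++ (blk.getLast?.elim [] fun a => [Tok.sym (glob a)])

/-- Auxiliary function for the shuffle: traverse `B` (relabeling its symbols by
`glob`), replacing its `i`-th special block by the modified `i`-th copy of `A`. -/
def bulletAux (A : List Tok) : ℕ → List Tok → List Tok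
  | _, [] => []
  | i, Tok.op :: r => copyA i A (takeBlock r).1 ++ bulletAux A (i + 1) (takeBlock r).2
  | i, Tok.sym a :: r => Tok.sym (glob a) :: bulletAux A i r
  | i, Tok.cl :: r => Tok.cl :: bulletAux A i r
termination_by _ l => l.length
decreasing_by
  · exact Nat.lt_succ_of_le (takeBlock_len r)
  · exact Nat.lt_succ_self _
  · exact Nat.lt_succ_self _

/-- The shuffle `A • B` of two sequences with special blocks. -/
def bullet (A B : List Tok) : List Tok := bulletAux A 0 B

/-- Split each special block of length 2 into two special blocks of length 1. -/
def split2 : List Tok → List Tok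
  | Tok.op :: Tok.sym a :: Tok.sym b :: Tok.cl :: r =>
      Tok.op :: Tok.sym a :: Tok.cl :: Tok.op :: Tok.sym b :: Tok.cl :: split2 r
  | t :: r => t :: split2 r
  | [] => []

/-- The Hart–Sharir sequence `S₁(m) = (1 2 ⋯ m) (m−1) ⋯ 2 1 2 ⋯ m`,
with a single special block `(1 2 ⋯ m)`. -/
def S1 (m : ℕ) : List Tok :=
  Tok.op :: ((List.range' 1 m).map Tok.sym) ++ Tok.cl ::
    (((List.range' 1 (m - 1)).reverse.map Tok.sym) ++ ((List.range' 2 (m - 1)).map Tok.sym))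

/-- The number of special blocks of a token sequence. -/
def numBlocks (S : List Tok) : ℕ := S.count Tok.op

/-- The Hart–Sharir sequences `S_k(m)`, defined by double recursion:
`S₁(m)` is the `N`-shaped sequence above; for `k ≥ 2`, `S_k(1)` is `S_{k−1}(2)` with
each special block of length 2 split into two special blocks of length 1; and for
`k, m ≥ 2`, `S_k(m) = S_k(m−1) • S_{k−1}(N)` where `N` is the number of special
blocks of `S_k(m−1)`.  (The value for `k = 0` or `m = 0` is junk.) -/
def HS : ℕ → ℕ → List Tok
  | 0, _ => []
  | 1, m => S1 m
  | _ + 2, 0 => []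
  | k + 2, 1 => split2 (HS (k + 1) 2)
  | k + 2, m + 2 => bullet (HS (k + 2) (m + 1)) (HS (k + 1) (numBlocks (HS (k + 2) (m + 1))))
termination_by k m => (k, m)



/-- The list of special blocks of a token sequence (each block as its list of symbols). -/
def blocksOf : List Tok → List (List ℕ)
  | [] => []
  | Tok.op :: r => (takeBlock r).1 :: blocksOf (takeBlock r).2
  | _ :: r => blocksOf r
termination_by l => l.length
decreasing_by
  · exact Nat.lt_succ_of_le (takeBlock_len r)
  · exact Nat.lt_succ_self _

/-- The rank of a symbol: the position (counting from 1) that its first occurrence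
occupies within its special block (`0` if the symbol lies in no special block). -/
def rankOf (S : List Tok) (a : ℕ) : ℕ :=
  match (blocksOf S).find? (fun b => decide (a ∈ b)) with
  | some b => b.idxOf a + 1
  | none => 0

/-- Two symbols have their first occurrences in the same special block. -/
def SameBlock (S : List Tok) (a b : ℕ) : Prop :=
  ∃ blk ∈ blocksOf S, a ∈ blk ∧ b ∈ blk

/-- The symbol `a` is left-clamped in the sequence `s`: `s` contains the
subsequence `b a b a`, where `b` is the symbol immediately preceding the first
occurrence of `a` in `s`. -/
def LeftClamped (s : List ℕ) (a : ℕ) : Prop :=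
  ∃ (u v : List ℕ) (b : ℕ), s = u ++ b :: a :: v ∧ a ∉ u ∧ b ≠ a ∧
    [b, a, b, a].Sublist s

/-- The symbol `a` is right-clamped in the sequence `s`: `s` contains the
subsequence `a b a b`, where `b` is the symbol immediately following the last
occurrence of `a` in `s`. -/
def RightClamped (s : List ℕ) (a : ℕ) : Prop :=
  ∃ (u v : List ℕ) (b : ℕ), s = u ++ a :: b :: v ∧ a ∉ v ∧ b ≠ a ∧
    [a, b, a, b].Sublist s

/-- Auxiliary function for the endpoint sequence: the first argument collects the
symbols already seen.  The first occurrence of each symbol becomes an `L` letter,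
its last occurrence becomes an `R` letter, all other occurrences are deleted, and
parentheses are kept. -/
def EAux : List ℕ → List Tok → List ETok
  | _, [] => []
  | seen, Tok.op :: r => ETok.op :: EAux seen r
  | seen, Tok.cl :: r => ETok.cl :: EAux seen r
  | seen, Tok.sym a :: r =>
      if a ∈ seen then
        if a ∈ symsOf r then EAux seen r else ETok.R a :: EAux seen r
      else ETok.L a :: EAux (a :: seen) r

/-- The endpoint sequence `E(S)` of a sequence with special blocks. -/
def Efun (S : List Tok) : List ETok := EAux [] S

/-- Read a special block of an endpoint sequence: the labels of the `L` letters up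
to the next closing parenthesis, and the remainder of the list after it. -/
def takeBlockE : List ETok → List ℕ × List ETok
  | [] => ([], [])
  | ETok.cl :: r => ([], r)
  | ETok.L a :: r => ((takeBlockE r).1.cons a, (takeBlockE r).2)
  | _ :: r => takeBlockE r

theorem takeBlockE_len : ∀ l : List ETok, (takeBlockE l).2.length ≤ l.length := by
  intro l
  induction l with
  | nil => simp [takeBlockE]
  | cons t r ih => cases t <;> simp [takeBlockE] <;> omega

/-- Auxiliary function for the endpoint shuffle `A ∘ B`: traverse the `i`-th fresh
copy of `A` (relabeling by `loc i`), inserting the next left-endpoint letter of the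
list `ins` (relabeled by `glob`) at the end of each special block. -/
def ecopyIns (i : ℕ) : List ETok → List ℕ → List ETok
  | [], _ => []
  | ETok.L a :: r, ins => ETok.L (loc i a) :: ecopyIns i r ins
  | ETok.R a :: r, ins => ETok.R (loc i a) :: ecopyIns i r ins
  | ETok.op :: r, ins => ETok.op :: ecopyIns i r ins
  | ETok.cl :: r, b :: ins => ETok.L (glob b) :: ETok.cl :: ecopyIns i r ins
  | ETok.cl :: r, [] => ETok.cl :: ecopyIns i r []

/-- Auxiliary function for the endpoint shuffle: traverse `B` (relabeling by
`glob`), replacing its `i`-th special block by the `i`-th modified copy of `A`. -/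
def eshufAux (A : List ETok) : ℕ → List ETok → List ETok
  | _, [] => []
  | i, ETok.op :: r => ecopyIns i A (takeBlockE r).1 ++ eshufAux A (i + 1) (takeBlockE r).2
  | i, ETok.L a :: r => ETok.L (glob a) :: eshufAux A i r
  | i, ETok.R a :: r => ETok.R (glob a) :: eshufAux A i r
  | i, ETok.cl :: r => ETok.cl :: eshufAux A i r
termination_by _ l => l.length
decreasing_by
  · exact Nat.lt_succ_of_le (takeBlockE_len r)
  · exact Nat.lt_succ_self _
  · exact Nat.lt_succ_self _
  · exact Nat.lt_succ_self _

/-- The endpoint shuffle `A ∘ B` of two endpoint sequences with special blocks. -/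
def eshuffle (A B : List ETok) : List ETok := eshufAux A 0 B

/-- The token list is a well-formed sequence with special blocks: a concatenation
of symbols and of parenthesized blocks consisting only of symbols. -/
inductive Blocked : List Tok → Prop
  | nil : Blocked []
  | sym (a : ℕ) {l : List Tok} : Blocked l → Blocked (Tok.sym a :: l)
  | blk (b : List ℕ) {l : List Tok} :
      Blocked l → Blocked (Tok.op :: b.map Tok.sym ++ Tok.cl :: l)

/-- The special blocks of `S` contain only first occurrences of symbols, and every
symbol of `S` makes its first occurrence inside a special block. -/
def FirstOccBlocks (S : List Tok) : Prop :=
  (∀ (u b v : List Tok), S = u ++ Tok.op :: b ++ Tok.cl :: v →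
      ∀ a : ℕ, Tok.sym a ∈ b → a ∉ symsOf u ∧ (symsOf b).count a = 1) ∧
  (∀ a ∈ symsOf S, ∃ (u b v : List Tok),
      S = u ++ Tok.op :: b ++ Tok.cl :: v ∧ Tok.sym a ∈ b ∧ a ∉ symsOf u)

/-! ### Sequences with special blocks as lists of items -/

/-- An item of a sequence with special blocks: a single symbol outside the blocks, or a block. -/
inductive SeqItem : Type where
  | sym : ℕ → SeqItem
  | blk : List ℕ → SeqItem

namespace SeqItem

/-- The token encoding of an item. -/
def toToks : SeqItem → List Tok
  | sym a => [Tok.sym a]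
  | blk d => Tok.op :: (d.map Tok.sym ++ [Tok.cl])

/-- The occurrences of symbols in an item, marked `true` inside blocks. -/
def marks : SeqItem → List (ℕ × Bool)
  | sym a => [(a, false)]
  | blk d => d.map fun a => (a, true)

/-- Duplicate the last symbol of a block immediately after the block. -/
def dup : SeqItem → List SeqItem
  | sym a => [sym a]
  | blk d => blk d :: d.getLast?.toList.map sym

/-- Split a block of length 2 into two blocks of length 1. -/
def split : SeqItem → List SeqItem
  | blk [a, b] => [blk [a], blk [b]]
  | t => [t]

/-- Whether an item is a block. -/
def isBlk : SeqItem → Bool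
  | sym _ => false
  | blk _ => true

end SeqItem

open SeqItem

/-- The token encoding of a list of items. -/
def itemToks (X : List SeqItem) : List Tok := X.flatMap toToks

/-- The marked occurrences of symbols in a list of items. -/
def itemMarks (X : List SeqItem) : List (ℕ × Bool) := X.flatMap marks

/-- The underlying sequence of symbols of a list of items. -/
def itemSyms (X : List SeqItem) : List ℕ := (itemMarks X).map Prod.fst

/-- Duplicate the last symbol of each block immediately after the block. -/
def itemDup (X : List SeqItem) : List SeqItem := X.flatMap dup

@[simp] theorem itemToks_nil : itemToks [] = [] := rfl
@[simp] theorem itemToks_sym (a : ℕ) (X : List SeqItem) :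
    itemToks (sym a :: X) = Tok.sym a :: itemToks X := rfl
@[simp] theorem itemToks_blk (d : List ℕ) (X : List SeqItem) :
    itemToks (blk d :: X) = Tok.op :: (d.map Tok.sym ++ Tok.cl :: itemToks X) := by
  simp [itemToks, toToks]
@[simp] theorem itemToks_append (X Y : List SeqItem) :
    itemToks (X ++ Y) = itemToks X ++ itemToks Y := List.flatMap_append
theorem itemToks_map_sym (d : List ℕ) :
    itemToks (d.map SeqItem.sym) = d.map Tok.sym := by
  induction d <;> simp_all

@[simp] theorem itemMarks_nil : itemMarks [] = [] := rfl
@[simp] theorem itemMarks_sym (a : ℕ) (X : List SeqItem) :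
    itemMarks (sym a :: X) = (a, false) :: itemMarks X := rfl
@[simp] theorem itemMarks_blk (d : List ℕ) (X : List SeqItem) :
    itemMarks (blk d :: X) = d.map (fun a => (a, true)) ++ itemMarks X := rfl
@[simp] theorem itemMarks_append (X Y : List SeqItem) :
    itemMarks (X ++ Y) = itemMarks X ++ itemMarks Y := List.flatMap_append
@[simp] theorem itemMarks_map_sym (d : List ℕ) :
    itemMarks (d.map SeqItem.sym) = d.map fun a => (a, false) := by
  induction d <;> simp_all

@[simp] theorem itemDup_nil : itemDup [] = [] := rfl
@[simp] theorem itemDup_sym (a : ℕ) (X : List SeqItem) :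
    itemDup (sym a :: X) = sym a :: itemDup X := rfl
@[simp] theorem itemDup_blk (d : List ℕ) (X : List SeqItem) :
    itemDup (blk d :: X) = blk d :: (d.getLast?.toList.map SeqItem.sym ++ itemDup X) := rfl
@[simp] theorem itemDup_append (X Y : List SeqItem) :
    itemDup (X ++ Y) = itemDup X ++ itemDup Y := List.flatMap_append
theorem itemDup_map_sym (d : List ℕ) :
    itemDup (d.map SeqItem.sym) = d.map SeqItem.sym := by
  induction d <;> simp_all

theorem itemMarks_sublist_dup (X : List SeqItem) :
    (itemMarks X).Sublist (itemMarks (itemDup X)) := by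
  induction X with
  | nil => simp
  | cons t X ih =>
    cases t with
    | sym a => simpa using ih
    | blk d => simpa using ih.trans (List.sublist_append_right _ _)

theorem itemSyms_sublist_dup (X : List SeqItem) : (itemSyms X).Sublist (itemSyms (itemDup X)) :=
  (itemMarks_sublist_dup X).map _

theorem symsOf_append (u v : List Tok) : symsOf (u ++ v) = symsOf u ++ symsOf v := by
  induction u with
  | nil => rfl
  | cons t u ih => cases t <;> simp [symsOf, ih]

theorem symsOf_map_sym (d : List ℕ) : symsOf (d.map Tok.sym) = d := by
  induction d <;> simp_all [symsOf]

theorem symsOf_itemToks (X : List SeqItem) : symsOf (itemToks X) = itemSyms X := by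
  unfold itemSyms
  induction X with
  | nil => rfl
  | cons t X ih =>
    cases t <;> simp [symsOf, symsOf_append, symsOf_map_sym, ih, Function.comp_def]

/-! ### Relabelings -/

theorem glob_or_loc (x : ℕ) : (∃ a, x = glob a) ∨ ∃ i a, x = loc i a := by
  rcases Nat.even_or_odd' x with ⟨y, rfl | rfl⟩
  · exact Or.inr ⟨y.unpair.1, y.unpair.2, by simp [loc]⟩
  · exact Or.inl ⟨y, rfl⟩

@[simp] theorem loc_ne_glob (i a b : ℕ) : loc i a ≠ glob b := by
  unfold loc glob; omega

@[simp] theorem glob_ne_loc (i a b : ℕ) : glob b ≠ loc i a := (loc_ne_glob i a b).symm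

@[simp] theorem glob_inj {a b : ℕ} : glob a = glob b ↔ a = b := by
  unfold glob; omega

@[simp] theorem loc_inj {i j a b : ℕ} : loc i a = loc j b ↔ i = j ∧ a = b := by
  simp [loc]

/-- The partial inverse of `glob`. -/
def unglob (x : ℕ) : Option ℕ := if x % 2 = 1 then some (x / 2) else none

/-- The partial inverse of `loc i`. -/
def unloc (i x : ℕ) : Option ℕ :=
  if x % 2 = 0 ∧ (x / 2).unpair.1 = i then some (x / 2).unpair.2 else none

@[simp] theorem unglob_glob (a : ℕ) : unglob (glob a) = some a := by
  have h : glob a % 2 = 1 ∧ glob a / 2 = a := by unfold glob; omega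
  simp [unglob, h]
@[simp] theorem unglob_loc (i a : ℕ) : unglob (loc i a) = none := by
  simp [unglob, loc]
@[simp] theorem unloc_glob (i a : ℕ) : unloc i (glob a) = none := by
  have h : glob a % 2 = 1 := by unfold glob; omega
  simp [unloc, h]
@[simp] theorem unloc_loc_self (i a : ℕ) : unloc i (loc i a) = some a := by
  simp [unloc, loc]
theorem unloc_loc_of_ne {i j : ℕ} (h : j ≠ i) (a : ℕ) : unloc i (loc j a) = none := by
  simp [unloc, loc, h]

/-- Restrict a list of marked occurrences along a partial relabeling. -/
def restrict (f : ℕ → Option ℕ) (M : List (ℕ × Bool)) : List (ℕ × Bool) :=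
  M.filterMap fun p => (f p.1).map fun a => (a, p.2)

theorem map_fst_restrict (f : ℕ → Option ℕ) (M : List (ℕ × Bool)) :
    (restrict f M).map Prod.fst = (M.map Prod.fst).filterMap f := by
  simp [restrict, List.map_filterMap, List.filterMap_map, Function.comp_def]

/-! ### Duplicating first occurrences -/

/-- `DupFirst T s t`: the sequence `t` arises from `s` by doubling the first occurrences of some
symbols not in `T`. -/
inductive DupFirst : List ℕ → List ℕ → List ℕ → Prop
  | nil (T : List ℕ) : DupFirst T [] []
  | cons {T s t : List ℕ} (a : ℕ) : DupFirst (a :: T) s t → DupFirst T (a :: s) (a :: t)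
  | double {T s t : List ℕ} (a : ℕ) : a ∉ T → DupFirst (a :: T) s t →
      DupFirst T (a :: s) (a :: a :: t)

/-- Collapse the first two occurrences of each symbol not in `T` if they are adjacent. -/
def collapse : List ℕ → List ℕ → List ℕ
  | _, [] => []
  | _, [x] => [x]
  | T, x :: y :: w =>
      if x ∉ T ∧ x = y then x :: collapse (x :: T) w else x :: collapse (x :: T) (y :: w)

theorem collapse_cons_of_mem {T : List ℕ} {x : ℕ} (hx : x ∈ T) (w : List ℕ) :
    collapse T (x :: w) = x :: collapse (x :: T) w := by
  cases w <;> simp [collapse, hx]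

theorem collapse_sublist_of_subset (w : List ℕ) {T U : List ℕ} (h : T ⊆ U) :
    (collapse T w).Sublist (collapse U w) := by
  induction w using List.twoStepInduction generalizing T U with
  | nil => simp [collapse]
  | singleton x => simp [collapse]
  | cons_cons x y w ih ih' =>
    have h' : x :: T ⊆ x :: U := List.cons_subset_cons x h
    by_cases hT : x ∉ T ∧ x = y
    · obtain ⟨hxT, rfl⟩ := hT
      by_cases hU : x ∈ U
      · simp only [collapse, hxT, hU]
        simp only [not_true_eq_false, false_and, if_false, not_false_eq_true, and_self, if_true]
        rw [collapse_cons_of_mem (by simp)]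
        exact ((ih (List.Subset.trans h' (by simp))).cons _).cons_cons _
      · simpa [collapse, hxT, hU] using ih h'
    · have hU : ¬ (x ∉ U ∧ x = y) := fun hU => hT ⟨fun hx => hU.1 (h hx), hU.2⟩
      simp only [collapse, hT, hU, if_false]
      exact (ih' _ h').cons_cons _

theorem collapse_cons_sublist {T s t w : List ℕ} {a : ℕ}
    (h : ∀ w : List ℕ, w.Sublist t → (collapse (a :: T) w).Sublist s) (hw : w.Sublist (a :: t)) :
    (collapse T w).Sublist (a :: s) := by
  cases hw with
  | cons _ hw =>
    exact ((collapse_sublist_of_subset w (List.subset_cons_self a T)).trans (h w hw)).cons a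
  | cons_cons _ hw =>
    rename_i w
    cases w with
    | nil => simp [collapse]
    | cons y w =>
      rw [collapse]
      split_ifs
      · exact (h w ((List.sublist_cons_self y w).trans hw)).cons_cons a
      · exact (h (y :: w) hw).cons_cons a

theorem DupFirst.collapse_sublist {T s t w : List ℕ} (h : DupFirst T s t) (hw : w.Sublist t) :
    (collapse T w).Sublist s := by
  induction h generalizing w with
  | nil T => simp_all [collapse]
  | @cons T s t a h ih => exact collapse_cons_sublist (fun w => ih) hw
  | @double T s t a ha h ih =>
    cases hw with
    | cons _ hw => exact collapse_cons_sublist (fun w => ih) hw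
    | cons_cons _ hw =>
      cases hw with
      | cons _ hw => exact collapse_cons_sublist (fun w => ih) (hw.cons_cons a)
      | cons_cons _ hw => simpa [collapse, ha] using ih hw

theorem DupFirst.append_left {s t : List ℕ} (e : List ℕ) {T : List ℕ}
    (h : DupFirst (e.reverse ++ T) s t) : DupFirst T (e ++ s) (e ++ t) := by
  induction e generalizing T with
  | nil => simpa using h
  | cons a e ih => exact DupFirst.cons a (ih (by simpa using h))

/-- Marked occurrences are first occurrences. -/
def FirstMarks (M : List (ℕ × Bool)) : Prop := M.Pairwise fun p q => q.2 = true → p.1 ≠ q.1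

theorem FirstMarks.not_sublist {M : List (ℕ × Bool)} (h : FirstMarks M) (x : ℕ) (s : Bool) :
    ¬ [(x, s), (x, true)].Sublist M := fun hs =>
  List.pairwise_iff_forall_sublist.1 h hs rfl rfl

theorem mem_itemMarks_of_mem_dup {X : List SeqItem} {x : ℕ}
    (h : (x, true) ∈ itemMarks (itemDup X)) : (x, true) ∈ itemMarks X := by
  induction X with
  | nil => simp at h
  | cons t X ih => cases t <;> simp_all; grind

theorem FirstMarks.itemDup {X : List SeqItem} (h : FirstMarks (itemMarks X)) :
    FirstMarks (itemMarks (itemDup X)) := by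
  unfold FirstMarks at *
  induction X with
  | nil => simp
  | cons t X ih =>
    cases t with
    | sym a =>
      simp only [itemMarks_sym, itemDup_sym, List.pairwise_cons] at h ⊢
      refine ⟨?_, ih h.2⟩
      rintro ⟨x, s⟩ hx rfl
      exact h.1 _ (mem_itemMarks_of_mem_dup hx) rfl
    | blk d =>
      simp only [itemMarks_blk, itemDup_blk, List.pairwise_append, itemMarks_append,
        itemMarks_map_sym] at h ⊢
      have key : ∀ a ∈ d, ∀ q ∈ itemMarks (_root_.itemDup X), q.2 = true → a ≠ q.1 := by
        rintro a ha ⟨x, s⟩ hx rfl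
        exact h.2.2 (a, true) (by simpa using ha) _ (mem_itemMarks_of_mem_dup hx) rfl
      have hlast : ∀ a ∈ d.getLast?.toList, a ∈ d := by
        intro a ha
        exact List.mem_of_getLast? (by simpa using ha)
      refine ⟨h.1, ⟨?_, ih h.2.1, ?_⟩, ?_⟩
      · cases d.getLast? <;> simp
      · simp only [List.mem_map]
        rintro _ ⟨a, ha, rfl⟩ q hq
        exact key a (hlast a ha) q hq
      · simp only [List.mem_map, List.mem_append]
        rintro _ ⟨a, ha, rfl⟩ q (⟨b, hb, rfl⟩ | hq)
        · simp
        · exact key a ha q hq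

theorem dupFirst_itemDup {X : List SeqItem} {T : List ℕ} (h : FirstMarks (itemMarks X))
    (hT : ∀ x ∈ T, (x, true) ∉ itemMarks X) :
    DupFirst T (itemSyms X) (itemSyms (itemDup X)) := by
  unfold FirstMarks itemSyms at *
  induction X generalizing T with
  | nil => exact DupFirst.nil T
  | cons t X ih =>
    cases t with
    | sym a =>
      simp only [itemMarks_sym, itemDup_sym, List.pairwise_cons, List.map_cons, List.mem_cons,
        not_or] at h hT ⊢
      refine DupFirst.cons a (ih h.2 ?_)
      intro x hx hm
      rcases List.mem_cons.1 hx with rfl | hx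
      · exact h.1 _ hm rfl rfl
      · exact (hT x hx).2 hm
    | blk d =>
      rcases List.eq_nil_or_concat d with rfl | ⟨e, z, rfl⟩
      · simpa using ih (by simpa using h) (by simpa using hT)
      · simp only [itemMarks_blk, List.pairwise_append, List.mem_append, not_or, List.mem_map,
          List.concat_eq_append] at h hT
        have hnd : z ∉ e := by
          have := h.1
          simp only [List.map_append, List.pairwise_append] at this
          intro hz
          exact this.2.2 (z, true) (by simpa using hz) (z, true) (by simp) rfl rfl
        have := DupFirst.append_left e (T := T)
          (DupFirst.double z ?_ (ih h.2.1 (T := z :: (e.reverse ++ T)) ?_))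
        · simpa [Function.comp_def] using this
        · simp only [List.mem_append, List.mem_reverse, not_or]
          exact ⟨hnd, fun hz => (hT z hz).1 ⟨z, by simp⟩⟩
        · intro x hx hm
          simp only [List.mem_cons, List.mem_append, List.mem_reverse] at hx
          by_cases hxT : x ∈ T
          · exact (hT x hxT).2 hm
          · refine h.2.2 (x, true) ⟨x, ?_, rfl⟩ _ hm rfl rfl
            grind

/-! ### The shuffle on lists of items -/

/-- The `i`-th copy of a list of items, with the symbols `ins` inserted into its blocks. -/
def copyItems (i : ℕ) : List SeqItem → List ℕ → List SeqItem
  | [], _ => []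
  | sym a :: X, ins => sym (loc i a) :: copyItems i X ins
  | blk d :: X, [] => blk (d.map (loc i)) :: copyItems i X []
  | blk d :: X, b :: ins =>
      blk (d.map (loc i) ++ [glob b]) ::
        (d.getLast?.toList.map fun z => sym (loc i z)) ++ copyItems i X ins

/-- The shuffle of two lists of items, with copies numbered from `j`. -/
def bulletItems (A : List SeqItem) : ℕ → List SeqItem → List SeqItem
  | _, [] => []
  | j, sym a :: B => sym (glob a) :: bulletItems A j B
  | j, blk d :: B =>
      copyItems j A d ++ (d.getLast?.toList.map fun z => sym (glob z)) ++ bulletItems A (j + 1) B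

theorem copyIns_map_sym (i : ℕ) (d : List ℕ) (z : ℕ) (r : List Tok) (ins : List ℕ) (p : Option ℕ) :
    copyIns i ((d ++ [z]).map Tok.sym ++ r) ins p =
      ((d ++ [z]).map (loc i)).map Tok.sym ++ copyIns i r ins (some (loc i z)) := by
  induction d generalizing p with
  | nil => simp [copyIns]
  | cons a d ih => simpa [copyIns] using ih _

theorem copyIns_itemToks (i : ℕ) (X : List SeqItem) (hX : ∀ d, blk d ∈ X → d ≠ [])
    (ins : List ℕ) (p : Option ℕ) :
    copyIns i (itemToks X) ins p = itemToks (copyItems i X ins) := by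
  induction X generalizing ins p with
  | nil => simp [copyIns, copyItems]
  | cons t X ih =>
    replace ih := ih fun d hd => hX d (List.mem_cons_of_mem _ hd)
    cases t with
    | sym a => simp [copyIns, copyItems, ih]
    | blk d =>
      rcases List.eq_nil_or_concat d with rfl | ⟨e, z, rfl⟩
      · exact absurd rfl (hX [] (by simp))
      · rw [List.concat_eq_append, itemToks_blk, copyIns, copyIns_map_sym]
        cases ins <;> simp [copyIns, copyItems, ih]

theorem takeBlock_map_sym (d : List ℕ) (r : List Tok) :
    takeBlock (d.map Tok.sym ++ Tok.cl :: r) = (d, r) := by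
  induction d <;> simp_all [takeBlock]

theorem bulletAux_itemToks (A : List SeqItem) (hA : ∀ d, blk d ∈ A → d ≠ []) (j : ℕ)
    (B : List SeqItem) : bulletAux (itemToks A) j (itemToks B) = itemToks (bulletItems A j B) := by
  induction B generalizing j with
  | nil => simp [bulletAux, bulletItems]
  | cons t B ih =>
    cases t with
    | sym a => simp [bulletAux, bulletItems, ih]
    | blk d =>
      simp only [itemToks_blk, bulletAux, takeBlock_map_sym, bulletItems, itemToks_append, ih, copyA,
        copyIns_itemToks j A hA]
      cases d.getLast? <;> simp

theorem restrict_append (f : ℕ → Option ℕ) (M M' : List (ℕ × Bool)) :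
    restrict f (M ++ M') = restrict f M ++ restrict f M' := List.filterMap_append

theorem itemMarks_map_sym_comp (f : ℕ → ℕ) (d : List ℕ) :
    itemMarks (d.map fun z => SeqItem.sym (f z)) = d.map fun z => (f z, false) := by
  simpa [Function.comp_def] using itemMarks_map_sym (d.map f)

theorem itemDup_map_sym_comp (f : ℕ → ℕ) (d : List ℕ) :
    itemDup (d.map fun z => SeqItem.sym (f z)) = d.map fun z => SeqItem.sym (f z) := by
  simpa [Function.comp_def] using itemDup_map_sym (d.map f)

theorem restrict_unglob_map_glob (s : Bool) (d : List ℕ) :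
    restrict unglob (d.map fun a => (glob a, s)) = d.map fun a => (a, s) := by
  simp [restrict, List.filterMap_map, List.filterMap_eq_map']

theorem restrict_unloc_map_glob (i : ℕ) (s : Bool) (d : List ℕ) :
    restrict (unloc i) (d.map fun a => (glob a, s)) = [] := by
  simp [restrict]

theorem restrict_unloc_map_loc (i : ℕ) (s : Bool) (d : List ℕ) :
    restrict (unloc i) (d.map fun a => (loc i a, s)) = d.map fun a => (a, s) := by
  simp [restrict, List.filterMap_map, List.filterMap_eq_map']

theorem restrict_unglob_copyItems (i : ℕ) (A : List SeqItem) (ins : List ℕ) :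
    (restrict unglob (itemMarks (copyItems i A ins))).Sublist (ins.map fun a => (a, true)) := by
  fun_induction copyItems i A ins with
  | case1 => simp [restrict]
  | case2 a X ins ih => simpa [restrict] using ih
  | case3 d X ih => simpa [restrict] using ih
  | case4 d X b ins ih =>
    simpa [itemMarks_map_sym_comp, restrict_append, restrict, Function.comp_def]
      using ih

theorem restrict_unglob_bulletItems (A : List SeqItem) (j : ℕ) (B : List SeqItem) :
    (restrict unglob (itemMarks (bulletItems A j B))).Sublist (itemMarks (itemDup B)) := by
  fun_induction bulletItems A j B with
  | case1 => simp [restrict]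
  | case2 j a B ih => simpa [restrict] using ih
  | case3 j d B ih =>
    simp only [itemMarks_append, itemMarks_map_sym_comp, restrict_append, restrict_unglob_map_glob,
      itemDup_blk, itemMarks_blk, itemMarks_map_sym, List.append_assoc]
    exact (restrict_unglob_copyItems j A d).append ((List.Sublist.refl _).append ih)

theorem restrict_unloc_copyItems (i : ℕ) (A : List SeqItem) (ins : List ℕ) :
    (restrict (unloc i) (itemMarks (itemDup (copyItems i A ins)))).Sublist
      (itemMarks (itemDup A)) := by
  fun_induction copyItems i A ins with
  | case1 => simp [restrict]
  | case2 a X ins ih => simpa [restrict] using ih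
  | case3 d X ih =>
    have h (s : Bool) : restrict (unloc i)
        ((Option.map (loc i) d.getLast?).toList.map fun a => (a, s)) =
          d.getLast?.toList.map fun a => (a, s) := by
      cases d.getLast? <;> simp [restrict]
    simpa [h, restrict_append, restrict_unloc_map_loc, Function.comp_def] using ih
  | case4 d X b ins ih =>
    have hb : ∀ s, restrict (unloc i) [(glob b, s)] = [] := by simp [restrict]
    have hb' : ∀ s M, restrict (unloc i) ((glob b, s) :: M) = restrict (unloc i) M := by
      simp [restrict]
    simpa [itemMarks_map_sym_comp, itemDup_map_sym_comp, restrict_append, restrict_unloc_map_loc,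
      Function.comp_def, hb, hb'] using ih

theorem mem_copyItems_marks {i : ℕ} {A : List SeqItem} {ins : List ℕ} {q : ℕ × Bool}
    (h : q ∈ itemMarks (itemDup (copyItems i A ins))) :
    (∃ a, q.1 = loc i a) ∨ ∃ a, q.1 = glob a := by
  fun_induction copyItems i A ins with
  | case1 => simp at h
  | case2 a X ins ih =>
    rcases List.mem_cons.1 h with rfl | h
    · exact Or.inl ⟨a, rfl⟩
    · exact ih h
  | case3 d X ih =>
    simp at h
    rcases h with ⟨a, _, rfl⟩ | ⟨a, _, rfl⟩ | h
    · exact Or.inl ⟨a, rfl⟩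
    · exact Or.inl ⟨a, rfl⟩
    · exact ih h
  | case4 d X b ins ih =>
    simp [itemMarks_map_sym_comp, itemDup_map_sym_comp] at h
    rcases h with ⟨a, _, rfl⟩ | rfl | rfl | ⟨a, _, rfl⟩ | h
    · exact Or.inl ⟨a, rfl⟩
    · exact Or.inr ⟨b, rfl⟩
    · exact Or.inr ⟨b, rfl⟩
    · exact Or.inl ⟨a, rfl⟩
    · exact ih h

theorem mem_copyItems_glob {i : ℕ} {A : List SeqItem} {ins : List ℕ} {x : ℕ} {s : Bool}
    (h : (glob x, s) ∈ itemMarks (copyItems i A ins)) : s = true := by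
  have hx : (x, s) ∈ restrict unglob (itemMarks (copyItems i A ins)) :=
    List.mem_filterMap.2 ⟨_, h, by simp⟩
  have hs := (restrict_unglob_copyItems i A ins).subset hx
  simp only [List.mem_map, Prod.mk.injEq] at hs
  obtain ⟨a, _, _, rfl⟩ := hs
  rfl

theorem le_of_loc_mem_bulletItems {A : List SeqItem} {j : ℕ} {B : List SeqItem} {q : ℕ × Bool}
    {i a : ℕ} (h : q ∈ itemMarks (itemDup (bulletItems A j B))) (hq : q.1 = loc i a) : j ≤ i := by
  fun_induction bulletItems A j B with
  | case1 => simp at h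
  | case2 j b B ih =>
    simp only [itemDup_sym, itemMarks_sym, List.mem_cons] at h
    rcases h with rfl | h
    · simp at hq
    · exact ih h
  | case3 j d B ih =>
    simp only [itemDup_append, itemMarks_append, itemDup_map_sym_comp, itemMarks_map_sym_comp,
      List.mem_append, List.mem_map] at h
    rcases h with (h | ⟨z, _, rfl⟩) | h
    · rcases mem_copyItems_marks h with ⟨b, hb⟩ | ⟨b, hb⟩ <;> simp [hq] at hb
      omega
    · simp at hq
    · have := ih h
      omega

theorem restrict_unloc_eq_nil {i : ℕ} {M : List (ℕ × Bool)} (h : ∀ q ∈ M, ∀ a, q.1 ≠ loc i a) :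
    restrict (unloc i) M = [] := by
  simp only [restrict, List.filterMap_eq_nil_iff, Option.map_eq_none_iff]
  intro q hq
  rcases glob_or_loc q.1 with ⟨a, ha⟩ | ⟨j, a, ha⟩
  · simp [ha]
  · rw [ha]
    exact unloc_loc_of_ne (by rintro rfl; exact h q hq a ha) a

theorem restrict_unloc_bulletItems (A : List SeqItem) (i j : ℕ) (B : List SeqItem) :
    (restrict (unloc i) (itemMarks (itemDup (bulletItems A j B)))).Sublist
      (itemMarks (itemDup A)) := by
  fun_induction bulletItems A j B with
  | case1 => simp [restrict]
  | case2 j a B ih => simpa [restrict] using ih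
  | case3 j d B ih =>
    simp only [itemDup_append, itemMarks_append, itemDup_map_sym_comp, itemMarks_map_sym_comp,
      restrict_append, restrict_unloc_map_glob, List.append_nil]
    by_cases hij : j = i
    · subst hij
      rw [restrict_unloc_eq_nil (M := itemMarks (itemDup (bulletItems _ _ _))), List.append_nil]
      · exact restrict_unloc_copyItems j A d
      · intro q hq a ha
        have := le_of_loc_mem_bulletItems hq ha
        omega
    · rw [restrict_unloc_eq_nil (M := itemMarks (itemDup (copyItems _ _ _))), List.nil_append]
      · exact ih
      · intro q hq a ha
        rcases mem_copyItems_marks hq with ⟨b, hb⟩ | ⟨b, hb⟩ <;> simp [ha] at hb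
        omega

/-- A word in the shuffle between two local symbols of the same copy lies within that copy. -/
theorem exists_sublist_copyItems {A : List SeqItem} {j : ℕ} {B : List SeqItem} {i y y' : ℕ}
    {s s' : Bool} {w : List (ℕ × Bool)}
    (h : ((loc i y, s) :: w ++ [(loc i y', s')]).Sublist (itemMarks (bulletItems A j B))) :
    ∃ d, blk d ∈ B ∧ ((loc i y, s) :: w ++ [(loc i y', s')]).Sublist
      (itemMarks (copyItems i A d)) := by
  fun_induction bulletItems A j B with
  | case1 => simp at h
  | case2 j b B ih =>
    rw [itemMarks_sym, List.cons_append, List.cons_sublist_cons'] at h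
    rcases h with h | ⟨h, _⟩
    · obtain ⟨d, hd, hs⟩ := ih h
      exact ⟨d, List.mem_cons_of_mem _ hd, hs⟩
    · simp at h
  | case3 j d B ih =>
    rw [itemMarks_append, itemMarks_append, itemMarks_map_sym_comp, List.append_assoc] at h
    by_cases hij : j = i
    · subst hij
      refine ⟨d, List.mem_cons_self, ?_⟩
      obtain ⟨w₁, w₂, hw, h₁, h₂⟩ := List.sublist_append_iff.1 h
      rcases List.eq_nil_or_concat w₂ with rfl | ⟨v, q, rfl⟩
      · rw [hw, List.append_nil]
        exact h₁
      · exfalso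
        rw [List.concat_eq_append, ← List.append_assoc] at hw
        have hq := (List.append_inj_right' hw rfl)
        simp only [List.cons.injEq, and_true] at hq
        have hm := h₂.subset (show q ∈ v.concat q by simp)
        rw [← hq] at hm
        rcases List.mem_append.1 hm with hm | hm
        · simp at hm
        · have := le_of_loc_mem_bulletItems ((itemMarks_sublist_dup _).subset hm) rfl
          omega
    · rw [← List.append_assoc] at h
      obtain ⟨w₁, w₂, hw, h₁, h₂⟩ := List.sublist_append_iff.1 h
      cases w₁ with
      | nil =>
        rw [List.nil_append] at hw
        obtain ⟨d', hd, hs⟩ := ih (hw ▸ h₂)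
        exact ⟨d', List.mem_cons_of_mem _ hd, hs⟩
      | cons p w₁ =>
        exfalso
        simp only [List.cons_append, List.cons.injEq] at hw
        have hm := h₁.subset (List.mem_cons_self (a := p))
        rw [← hw.1] at hm
        rcases List.mem_append.1 hm with hm | hm
        · rcases mem_copyItems_marks ((itemMarks_sublist_dup _).subset hm) with
            ⟨b, hb⟩ | ⟨b, hb⟩ <;> simp at hb
          omega
        · simp at hm

/-! ### Patterns in the shuffle -/

theorem exists_marks_of_sublist_itemSyms {X : List SeqItem} {w : List ℕ}
    (h : w.Sublist (itemSyms X)) : ∃ M : List (ℕ × Bool), M.Sublist (itemMarks X) ∧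
      M.map Prod.fst = w := by
  obtain ⟨M, hM, rfl⟩ := List.sublist_map_iff.1 h
  exact ⟨M, hM, rfl⟩

theorem not_glob_loc_glob_loc {A B : List SeqItem} {j : ℕ}
    (hS : FirstMarks (itemMarks (bulletItems A j B))) (x i y : ℕ) :
    ¬ [glob x, loc i y, glob x, loc i y].Sublist (itemSyms (bulletItems A j B)) := by
  intro h
  obtain ⟨M, hM, hw⟩ := exists_marks_of_sublist_itemSyms h
  simp only [List.map_eq_cons_iff, List.map_eq_nil_iff] at hw
  obtain ⟨⟨_, s₁⟩, _, rfl, rfl, ⟨_, s₂⟩, _, rfl, rfl, ⟨_, s₃⟩, _, rfl, rfl, ⟨_, s₄⟩, _, rfl, rfl,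
    rfl⟩ := hw
  obtain ⟨d, _, hs⟩ := exists_sublist_copyItems (w := [(glob x, s₃)])
    ((List.sublist_cons_self _ _).trans hM)
  obtain rfl := mem_copyItems_glob (hs.subset (by simp : (glob x, s₃) ∈ _))
  exact hS.not_sublist (glob x) s₁ (List.Sublist.trans (by simp) hM)

theorem not_loc_glob_glob_loc {A B : List SeqItem} {j : ℕ}
    (hS : FirstMarks (itemMarks (bulletItems A j B))) (x i y : ℕ) :
    ¬ [loc i y, glob x, glob x, loc i y].Sublist (itemSyms (bulletItems A j B)) := by
  intro h
  obtain ⟨M, hM, hw⟩ := exists_marks_of_sublist_itemSyms h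
  simp only [List.map_eq_cons_iff, List.map_eq_nil_iff] at hw
  obtain ⟨⟨_, s₁⟩, _, rfl, rfl, ⟨_, s₂⟩, _, rfl, rfl, ⟨_, s₃⟩, _, rfl, rfl, ⟨_, s₄⟩, _, rfl, rfl,
    rfl⟩ := hw
  obtain ⟨d, _, hs⟩ := exists_sublist_copyItems (w := [(glob x, s₂), (glob x, s₃)]) hM
  obtain rfl := mem_copyItems_glob (hs.subset (by simp : (glob x, s₃) ∈ _))
  exact hS.not_sublist (glob x) s₂ (List.Sublist.trans (by simp) hM)

theorem eq_of_loc_loc_loc {A B : List SeqItem} {j i y i' y' : ℕ}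
    (h : [loc i y, loc i' y', loc i y].Sublist (itemSyms (bulletItems A j B))) : i' = i := by
  obtain ⟨M, hM, hw⟩ := exists_marks_of_sublist_itemSyms h
  simp only [List.map_eq_cons_iff, List.map_eq_nil_iff] at hw
  obtain ⟨⟨_, s₁⟩, _, rfl, rfl, ⟨_, s₂⟩, _, rfl, rfl, ⟨_, s₃⟩, _, rfl, rfl, rfl⟩ := hw
  obtain ⟨d, _, hs⟩ := exists_sublist_copyItems (w := [(loc i' y', s₂)]) hM
  have hm := hs.subset (by simp : (loc i' y', s₂) ∈ _)
  rcases mem_copyItems_marks ((itemMarks_sublist_dup _).subset hm) with ⟨b, hb⟩ | ⟨b, hb⟩ <;>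
    simp at hb
  exact hb.1

theorem exists_blk_of_loc_glob_glob_loc {A B : List SeqItem} {j i y b c : ℕ}
    (h : [loc i y, glob b, glob c, loc i y].Sublist (itemSyms (bulletItems A j B))) :
    ∃ d, blk d ∈ B ∧ [b, c].Sublist d := by
  obtain ⟨M, hM, hw⟩ := exists_marks_of_sublist_itemSyms h
  simp only [List.map_eq_cons_iff, List.map_eq_nil_iff] at hw
  obtain ⟨⟨_, s₁⟩, _, rfl, rfl, ⟨_, s₂⟩, _, rfl, rfl, ⟨_, s₃⟩, _, rfl, rfl, ⟨_, s₄⟩, _, rfl, rfl,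
    rfl⟩ := hw
  obtain ⟨d, hd, hs⟩ := exists_sublist_copyItems (w := [(glob b, s₂), (glob c, s₃)]) hM
  refine ⟨d, hd, ?_⟩
  have := ((hs.filterMap _).trans (restrict_unglob_copyItems i A d)).map Prod.fst
  simpa [Function.comp_def] using this

theorem filterMap_unglob_sublist {A B : List SeqItem} {j : ℕ} {w : List ℕ}
    (h : w.Sublist (itemSyms (bulletItems A j B))) :
    (w.filterMap unglob).Sublist (itemSyms (itemDup B)) := by
  have := (restrict_unglob_bulletItems A j B).map Prod.fst
  rw [map_fst_restrict] at this
  exact (h.filterMap unglob).trans this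

theorem filterMap_unloc_sublist {A B : List SeqItem} {j : ℕ} (i : ℕ) {w : List ℕ}
    (h : w.Sublist (itemSyms (itemDup (bulletItems A j B)))) :
    (w.filterMap (unloc i)).Sublist (itemSyms (itemDup A)) := by
  have := (restrict_unloc_bulletItems A i j B).map Prod.fst
  rw [map_fst_restrict] at this
  exact (h.filterMap (unloc i)).trans this

theorem exists_of_blk_mem_copyItems {i : ℕ} {A : List SeqItem} {ins D : List ℕ}
    (hins : A.countP isBlk ≤ ins.length) (h : blk D ∈ copyItems i A ins) :
    ∃ d b, blk d ∈ A ∧ D = d.map (loc i) ++ [glob b] := by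
  fun_induction copyItems i A ins with
  | case1 => simp at h
  | case2 a X ins ih =>
    obtain ⟨d, b, hd, hD⟩ := ih (by simpa [isBlk] using hins) (by simpa using h)
    exact ⟨d, b, List.mem_cons_of_mem _ hd, hD⟩
  | case3 d X ih => simp [isBlk] at hins
  | case4 e X b ins ih =>
    simp only [List.cons_append, List.mem_cons, SeqItem.blk.injEq, List.mem_append, List.mem_map,
      reduceCtorEq, and_false, exists_false, false_or] at h
    rcases h with h | h
    · exact ⟨e, b, List.mem_cons_self, h⟩
    · obtain ⟨d, b, hd, hD⟩ := ih (by simpa [isBlk, List.countP_cons] using hins) h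
      exact ⟨d, b, List.mem_cons_of_mem _ hd, hD⟩

theorem exists_of_blk_mem_bulletItems {A B : List SeqItem} {j : ℕ} {D : List ℕ}
    (hB : ∀ d, blk d ∈ B → A.countP isBlk ≤ d.length) (h : blk D ∈ bulletItems A j B) :
    ∃ i d b, blk d ∈ A ∧ D = d.map (loc i) ++ [glob b] := by
  fun_induction bulletItems A j B with
  | case1 => simp at h
  | case2 j a B ih => exact ih (fun d hd => hB d (List.mem_cons_of_mem _ hd)) (by simpa using h)
  | case3 j e B ih =>
    simp only [List.mem_append, List.mem_map, reduceCtorEq, and_false, exists_false,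
      or_false] at h
    rcases h with h | h
    · obtain ⟨d, b, hd, hD⟩ := exists_of_blk_mem_copyItems (hB e List.mem_cons_self) h
      exact ⟨j, d, b, hd, hD⟩
    · exact ih (fun d hd => hB d (List.mem_cons_of_mem _ hd)) h

/-! ### The invariant -/

/-- The invariant of the Hart–Sharir recursion: all blocks have length `m` and consist of first
occurrences, `abcaccbc` is avoided, and `bcccbc` with `b` preceding `c` in a common block is
avoided even after duplicating the last symbol of each block. -/
structure GoodItems (m : ℕ) (X : List SeqItem) : Prop where
  length_eq : ∀ d, blk d ∈ X → d.length = m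
  first : FirstMarks (itemMarks X)
  not_bcccbc : ∀ d b c, blk d ∈ X → [b, c].Sublist d →
    ¬ [b, c, c, c, b, c].Sublist (itemSyms (itemDup X))
  not_abcaccbc : ∀ a b c, a ≠ b → a ≠ c → b ≠ c → ¬ [a, b, c, a, c, c, b, c].Sublist (itemSyms X)

theorem FirstMarks.collapse_sublist {X : List SeqItem} (h : FirstMarks (itemMarks X)) {w : List ℕ}
    (hw : w.Sublist (itemSyms (_root_.itemDup X))) : (collapse [] w).Sublist (itemSyms X) :=
  (dupFirst_itemDup h (by simp)).collapse_sublist hw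

theorem GoodItems.not_abcaccbc_dup {m : ℕ} {X : List SeqItem} (h : GoodItems m X) {a b c : ℕ}
    (hab : a ≠ b) (hac : a ≠ c) (hbc : b ≠ c) :
    ¬ [a, b, c, a, c, c, b, c].Sublist (itemSyms (itemDup X)) := fun hw =>
  h.not_abcaccbc a b c hab hac hbc
    (by simpa [collapse, hab, hac, hbc, hab.symm, hac.symm, hbc.symm] using
      h.first.collapse_sublist hw)

theorem firstMarks_bulletItems {A B : List SeqItem} (hA : FirstMarks (itemMarks A))
    (hB : FirstMarks (itemMarks B)) (j : ℕ) : FirstMarks (itemMarks (bulletItems A j B)) := by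
  refine List.pairwise_iff_forall_sublist.2 ?_
  rintro ⟨x, s⟩ ⟨y, s'⟩ h (rfl : s' = true) (rfl : x = y)
  rcases glob_or_loc x with ⟨a, rfl⟩ | ⟨i, a, rfl⟩
  · refine hB.itemDup.not_sublist a s ?_
    simpa using (h.filterMap _).trans (restrict_unglob_bulletItems A j B)
  · refine hA.itemDup.not_sublist a s ?_
    simpa using ((h.trans (itemMarks_sublist_dup _)).filterMap _).trans
      (restrict_unloc_bulletItems A i j B)

theorem GoodItems.bulletItems {m : ℕ} {A B : List SeqItem} (hA : GoodItems m A)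
    (hB : GoodItems (A.countP isBlk) B) : GoodItems (m + 1) (bulletItems A 0 B) := by
  have hfirst := firstMarks_bulletItems hA.first hB.first 0
  have hlen : ∀ d, blk d ∈ B → A.countP isBlk ≤ d.length := fun d hd => (hB.length_eq d hd).ge
  refine ⟨?_, hfirst, ?_, ?_⟩
  · intro D hD
    obtain ⟨i, d, g, hd, rfl⟩ := exists_of_blk_mem_bulletItems hlen hD
    simp [hA.length_eq d hd]
  · intro D b c hD hbc hw
    obtain ⟨i, d, g, hd, rfl⟩ := exists_of_blk_mem_bulletItems hlen hD
    obtain ⟨w₁, w₂, hw₁₂, h₁, h₂⟩ := List.sublist_append_iff.1 hbc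
    rcases List.sublist_singleton.1 h₂ with rfl | rfl
    · rw [List.append_nil] at hw₁₂
      obtain ⟨l, hl, hlw⟩ := List.sublist_map_iff.1 (hw₁₂ ▸ h₁)
      obtain ⟨b', l', rfl, rfl, hl'⟩ := List.map_eq_cons_iff.1 hlw.symm
      obtain ⟨c', l'', rfl, rfl, hl''⟩ := List.map_eq_cons_iff.1 hl'
      obtain rfl := List.map_eq_nil_iff.1 hl''
      exact hA.not_bcccbc d b' c' hd hl (by simpa using filterMap_unloc_sublist i hw)
    · obtain ⟨rfl, rfl⟩ : w₁ = [b] ∧ c = glob g := by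
        rw [show [b, c] = [b] ++ [c] from rfl] at hw₁₂
        have := List.append_inj' hw₁₂ rfl
        simp_all
      obtain ⟨b', _, rfl⟩ := List.mem_map.1 (h₁.subset List.mem_cons_self)
      have hv := List.Sublist.trans (l₁ := [loc i b', glob g, glob g, glob g, loc i b'])
        (by simp) hw
      exact not_loc_glob_glob_loc hfirst g i b'
        (by simpa [collapse] using hfirst.collapse_sublist hv)
  · intro a b c hab hac hbc hw
    have sub {v : List ℕ} (hv : v.Sublist [a, b, c, a, c, c, b, c]) := hv.trans hw
    rcases glob_or_loc c with ⟨c, rfl⟩ | ⟨i, c, rfl⟩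
    · rcases glob_or_loc b with ⟨b, rfl⟩ | ⟨i, b, rfl⟩
      · rcases glob_or_loc a with ⟨a, rfl⟩ | ⟨i, a, rfl⟩
        · exact hB.not_abcaccbc_dup (by simpa using hab) (by simpa using hac) (by simpa using hbc)
            (by simpa using filterMap_unglob_sublist hw)
        · obtain ⟨d, hd, hs⟩ := exists_blk_of_loc_glob_glob_loc
            (sub (v := [loc i a, glob b, glob c, loc i a]) (by simp))
          exact hB.not_bcccbc d b c hd hs (by simpa using filterMap_unglob_sublist hw)
      · exact not_loc_glob_glob_loc hfirst c i b
          (sub (by simp [List.cons_sublist_cons']))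
    · rcases glob_or_loc b with ⟨b, rfl⟩ | ⟨i₂, b, rfl⟩
      · exact not_glob_loc_glob_loc hfirst b i c (sub (by simp [List.cons_sublist_cons']))
      rcases glob_or_loc a with ⟨a, rfl⟩ | ⟨i₁, a, rfl⟩
      · exact not_glob_loc_glob_loc hfirst a i c (sub (by simp))
      obtain rfl : i₂ = i₁ := eq_of_loc_loc_loc
        (sub (v := [loc i₁ a, loc i₂ b, loc i₁ a]) (by simp))
      obtain rfl : i₂ = i := eq_of_loc_loc_loc
        (sub (v := [loc i c, loc i₂ a, loc i c]) (by simp))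
      exact hA.not_abcaccbc_dup (by simpa using hab) (by simpa using hac) (by simpa using hbc)
        (by simpa using filterMap_unloc_sublist i₂ (hw.trans (itemSyms_sublist_dup _)))

theorem numBlocks_itemToks (X : List SeqItem) : numBlocks (itemToks X) = X.countP isBlk := by
  unfold numBlocks
  have h (d : List ℕ) : (d.map Tok.sym).count Tok.op = 0 := by simp [List.count_eq_zero]
  induction X with
  | nil => rfl
  | cons t X ih => cases t <;> simp [List.countP_cons, isBlk, ih, h]

theorem split2_itemToks {X : List SeqItem} (hX : ∀ d, blk d ∈ X → d.length = 2) :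
    split2 (itemToks X) = itemToks (X.flatMap split) := by
  induction X with
  | nil => simp [split2]
  | cons t X ih =>
    replace ih := ih fun d hd => hX d (List.mem_cons_of_mem _ hd)
    cases t with
    | sym a => simp [split2, split, ih]
    | blk d =>
      obtain ⟨a, b, rfl⟩ := List.length_eq_two.1 (hX d List.mem_cons_self)
      simp [split2, split, ih]

theorem itemMarks_split (X : List SeqItem) : itemMarks (X.flatMap split) = itemMarks X := by
  induction X with
  | nil => rfl
  | cons t X ih =>
    rw [List.flatMap_cons, itemMarks_append, ih]
    fun_cases SeqItem.split t <;> simp [itemMarks, SeqItem.marks]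

theorem GoodItems.split {X : List SeqItem} (h : GoodItems 2 X) : GoodItems 1 (X.flatMap split) := by
  have hlen : ∀ d, blk d ∈ X.flatMap SeqItem.split → d.length = 1 := by
    intro d hd
    obtain ⟨t, ht, hdt⟩ := List.mem_flatMap.1 hd
    cases t with
    | sym a => simp [SeqItem.split] at hdt
    | blk e =>
      obtain ⟨a, b, rfl⟩ := List.length_eq_two.1 (h.length_eq e ht)
      simp only [SeqItem.split, List.mem_cons, SeqItem.blk.injEq, List.not_mem_nil,
        or_false] at hdt
      rcases hdt with rfl | rfl <;> rfl
  refine ⟨hlen, by simpa [itemMarks_split] using h.first, ?_, ?_⟩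
  · intro d b c hd hbc
    have := hbc.length_le
    simp [hlen d hd] at this
  · simpa only [itemSyms, itemMarks_split] using h.not_abcaccbc

/-- The items of `S1 m`. -/
def itemsS1 (m : ℕ) : List SeqItem :=
  blk (List.range' 1 m) ::
    ((List.range' 1 (m - 1)).reverse ++ List.range' 2 (m - 1)).map SeqItem.sym

theorem itemToks_itemsS1 (m : ℕ) : itemToks (itemsS1 m) = S1 m := by
  rw [itemsS1, itemToks_blk, itemToks_map_sym]
  simp [S1]

theorem count_itemsS1_le (m c : ℕ) : (itemSyms (itemDup (itemsS1 m))).count c ≤ 3 := by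
  have h₁ : (List.range' 1 m).count c ≤ 1 := List.nodup_iff_count_le_one.1 List.nodup_range' c
  have h₂ : ((List.range' 1 m).getLast?.toList ++ List.range' 1 (m - 1)).count c ≤ 1 := by
    refine List.nodup_iff_count_le_one.1 ?_ c
    cases m with
    | zero => simp
    | succ m =>
      rw [List.range'_concat]
      simp [List.nodup_range']
  have h₃ : (List.range' 2 (m - 1)).count c ≤ 1 := List.nodup_iff_count_le_one.1 List.nodup_range' c
  simp only [List.count_append] at h₂
  simp only [itemsS1, itemDup_blk, itemDup_map_sym, itemSyms, itemMarks_blk, itemMarks_append,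
    itemMarks_map_sym]
  simp only [List.map_append, List.map_map, Function.comp_def, List.map_id',
    List.count_append, List.count_reverse]
  omega

theorem goodItems_itemsS1 (m : ℕ) : GoodItems m (itemsS1 m) := by
  refine ⟨?_, ?_, ?_, ?_⟩
  · intro d hd
    simp [itemsS1] at hd
    simp [hd]
  · rw [itemsS1, itemMarks_blk, itemMarks_map_sym]
    simp only [FirstMarks, List.pairwise_append,
      List.pairwise_map, List.mem_map]
    refine ⟨(List.nodup_range' (s := 1) (n := m)).imp fun h _ => h, ?_, ?_⟩
    · simp [List.pairwise_of_forall]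
    rintro _ _ _ ⟨b, _, rfl⟩ h
    simp at h
  · intro d b c _ _ h
    have h₁ := h.count_le c
    have h₂ := count_itemsS1_le m c
    simp [List.count_cons] at h₁
    omega
  · intro a b c _ _ _ h
    have h₁ := (h.trans (itemSyms_sublist_dup _)).count_le c
    have h₂ := count_itemsS1_le m c
    simp [List.count_cons] at h₁
    omega

theorem exists_goodItems_HS (k m : ℕ) : ∃ X, HS k m = itemToks X ∧ GoodItems m X := by
  have hnil (m : ℕ) : GoodItems m [] := by
    constructor <;> simp [FirstMarks, itemSyms]
  induction k, m using HS.induct with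
  | case1 m => exact ⟨[], by simp [HS], hnil m⟩
  | case2 m => exact ⟨itemsS1 m, by rw [HS, itemToks_itemsS1], goodItems_itemsS1 m⟩
  | case3 k => exact ⟨[], by simp [HS], hnil 0⟩
  | case4 k ih =>
    obtain ⟨X, hX, h⟩ := ih
    exact ⟨X.flatMap SeqItem.split, by rw [HS, hX, split2_itemToks h.length_eq], h.split⟩
  | case5 k m ihA ihB =>
    obtain ⟨A, hA, hA'⟩ := ihA
    obtain ⟨B, hB, hB'⟩ := ihB
    rw [hA, numBlocks_itemToks] at hB hB'
    refine ⟨bulletItems A 0 B, ?_, hA'.bulletItems hB'⟩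
    rw [HS, hA, numBlocks_itemToks, hB, bullet, bulletAux_itemToks]
    rintro d hd rfl
    simpa using hA'.length_eq [] hd

/-- The Hart–Sharir sequences avoid `abcaccbc` (Pettie): for all `k, m ≥ 1`,
`S_k(m)` contains no (not necessarily contiguous) subsequence
`a b c a c c b c` with `a`, `b`, `c` pairwise distinct symbols. -/
theorem HS_avoids_abcaccbc (k m : ℕ) (hk : 1 ≤ k) (hm : 1 ≤ m) :
    ¬ ∃ a b c : ℕ, a ≠ b ∧ a ≠ c ∧ b ≠ c ∧
      [a, b, c, a, c, c, b, c].Sublist (symsOf (HS k m)) := by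
  rintro ⟨a, b, c, hab, hac, hbc, h⟩
  obtain ⟨X, hX, hgood⟩ := exists_goodItems_HS k m
  rw [hX, symsOf_itemToks] at h
  exact hgood.not_abcaccbc a b c hab hac hbc h
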